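/- Let m ≥ 3 and let A, B ∈ F_2^m satisfy supp(B) ⊊ supp(A). Let D = Δ_A \ Δ_B. Then the binary linear code C_D is self-orthogonal if and only if either (|B| = 0 and |A| ≥ 3) or (|B| ≥ 3). -/

import Mathlib

open Finset

def supp {m : ℕ} (v : Fin m → ZMod 2) : Finset (Fin m) :=
  Finset.univ.filter fun i => v i ≠ 0

def wt {m : ℕ} (v : Fin m → ZMod 2) : ℕ := (supp v).card

def delta {m : ℕ} (A : Fin m → ZMod 2) : Finset (Fin m → ZMod 2) :=
  Finset.univ.filter fun v => supp v ⊆ supp A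

def deltaT {m : ℕ} (T : Finset (Fin m)) : Finset (Fin m → ZMod 2) :=
  Finset.univ.filter fun v => supp v ⊆ T

def hwt {ι : Type*} [Fintype ι] (c : ι → ZMod 2) : ℕ :=
  (Finset.univ.filter fun i => c i ≠ 0).card

def cw {m : ℕ} (D : Finset (Fin m → ZMod 2)) (u : Fin m → ZMod 2) : ↥D → ZMod 2 :=
  fun g => ∑ i, u i * (g : Fin m → ZMod 2) i

def codeC {m : ℕ} (D : Finset (Fin m → ZMod 2)) :
    Submodule (ZMod 2) (↥D → ZMod 2) :=
  LinearMap.range (Matrix.mulVecLin (Matrix.of fun (g : ↥D) (i : Fin m) => (g : Fin m → ZMod 2) i))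

def dualCode {ι : Type*} [Fintype ι] (C : Submodule (ZMod 2) (ι → ZMod 2)) :
    Submodule (ZMod 2) (ι → ZMod 2) where
  carrier := {w | ∀ c ∈ C, ∑ i, w i * c i = 0}
  zero_mem' := by simp
  add_mem' := by
    intro a b ha hb c hc
    have h := congrArg₂ (· + ·) (ha c hc) (hb c hc)
    simpa [add_mul, Finset.sum_add_distrib] using h
  smul_mem' := by
    intro r w hw c hc
    have h := congrArg (r * ·) (hw c hc)
    simpa [Finset.mul_sum, mul_assoc] using h

def isMinDist {ι : Type*} [Fintype ι] (C : Set (ι → ZMod 2)) (d : ℕ) : Prop :=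
  (∃ c ∈ C, c ≠ 0 ∧ hwt c = d) ∧ ∀ c ∈ C, c ≠ 0 → d ≤ hwt c

def chi {m : ℕ} (u v : Fin m → ZMod 2) : ℤ :=
  if supp u ∩ supp v = ∅ then 1 else 0

theorem mem_supp {m : ℕ} {v : Fin m → ZMod 2} {i : Fin m} : i ∈ supp v ↔ v i ≠ 0 := by
  simp [supp]

theorem mem_delta {m : ℕ} {A v : Fin m → ZMod 2} : v ∈ delta A ↔ supp v ⊆ supp A := by
  simp [delta]

theorem ZMod.eq_of_ne_zero_iff_two {a b : ZMod 2} (h : a ≠ 0 ↔ b ≠ 0) : a = b := by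
  revert a b; decide

theorem supp_injective {m : ℕ} : Function.Injective (supp : (Fin m → ZMod 2) → _) := by
  intro v w h
  funext i
  apply ZMod.eq_of_ne_zero_iff_two
  rw [← mem_supp, ← mem_supp, h]

/-- Flipping a coordinate `k ∈ supp A` outside `{i, j}` is an involution of `delta A` that
preserves `g i * g j`, so the sum vanishes modulo two unless `supp A = {i, j}`. -/
theorem sum_delta_mul {m : ℕ} (A : Fin m → ZMod 2) (i j : Fin m) :
    ∑ g ∈ delta A, g i * g j = if supp A = {i, j} then 1 else 0 := by
  split_ifs with h
  · have hi : A i ≠ 0 := mem_supp.1 (by simp [h])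
    have hj : A j ≠ 0 := mem_supp.1 (by simp [h])
    rw [Finset.sum_eq_single_of_mem A (mem_delta.2 subset_rfl)]
    · exact ZMod.eq_of_ne_zero_iff_two (by simp [hi, hj])
    · intro g hg hne
      by_contra hprod
      obtain ⟨hgi, hgj⟩ := mul_ne_zero_iff.1 hprod
      refine hne (supp_injective ((mem_delta.1 hg).antisymm ?_))
      rw [h]
      simp [Finset.insert_subset_iff, mem_supp, hgi, hgj]
  · by_cases hij : {i, j} ⊆ supp A
    · obtain ⟨k, hkA, hk⟩ := Finset.exists_of_ssubset (hij.ssubset_of_ne (Ne.symm h))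
      simp only [Finset.mem_insert, Finset.mem_singleton, not_or] at hk
      refine Finset.sum_involution (fun g _ => g + Pi.single k 1) ?_ ?_ ?_ ?_
      · intro g _
        simp only [Pi.add_apply, Pi.single_eq_of_ne (Ne.symm hk.1),
          Pi.single_eq_of_ne (Ne.symm hk.2), add_zero]
        exact CharTwo.add_self_eq_zero _
      · intro g _ _ heq
        simpa using congrFun heq k
      · intro g hg
        rw [mem_delta] at hg ⊢
        intro l hl
        by_cases hlk : l = k
        · exact hlk ▸ hkA
        · exact hg (by simpa [mem_supp, Pi.single_eq_of_ne hlk] using hl)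
      · intro g _
        funext l
        simp only [Pi.add_apply, add_assoc, CharTwo.add_self_eq_zero, add_zero]
    · refine Finset.sum_eq_zero fun g hg => ?_
      by_contra hprod
      obtain ⟨hgi, hgj⟩ := mul_ne_zero_iff.1 hprod
      refine hij (Finset.Subset.trans ?_ (mem_delta.1 hg))
      simp [Finset.insert_subset_iff, mem_supp, hgi, hgj]

theorem codeC_le_dualCode_iff {m : ℕ} (D : Finset (Fin m → ZMod 2)) :
    codeC D ≤ dualCode (codeC D) ↔ ∀ i j, ∑ g ∈ D, g i * g j = 0 := by
  constructor
  · intro h i j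
    have column_mem (k : Fin m) : (fun g : D => (g : Fin m → ZMod 2) k) ∈ codeC D :=
      ⟨Pi.single k 1, by ext g; simp⟩
    rw [← Finset.sum_coe_sort]
    exact h (column_mem i) _ (column_mem j)
  · rintro h _ ⟨u, rfl⟩ _ ⟨v, rfl⟩
    simp only [Matrix.mulVecLin_apply, Matrix.mulVec, dotProduct, Matrix.of_apply]
    rw [Finset.sum_coe_sort D fun g => (∑ i, g i * u i) * ∑ j, g j * v j]
    simp only [Finset.sum_mul_sum]
    rw [Finset.sum_comm]
    refine Finset.sum_eq_zero fun i _ => ?_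
    rw [Finset.sum_comm]
    refine Finset.sum_eq_zero fun j _ => ?_
    calc ∑ g ∈ D, g i * u i * (g j * v j) = (∑ g ∈ D, g i * g j) * (u i * v j) := by
          rw [Finset.sum_mul]
          exact Finset.sum_congr rfl fun g _ => by ring
      _ = 0 := by rw [h, zero_mul]

theorem Finset.exists_eq_pair_iff {α : Type*} [DecidableEq α] (s : Finset α) :
    (∃ i j, s = {i, j}) ↔ s.card = 1 ∨ s.card = 2 := by
  constructor
  · rintro ⟨i, j, rfl⟩
    by_cases h : i = j
    · simp [h]
    · exact Or.inr (Finset.card_pair h)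
  · rintro (h | h)
    · obtain ⟨i, rfl⟩ := Finset.card_eq_one.1 h
      exact ⟨i, i, by simp⟩
    · obtain ⟨i, j, -, rfl⟩ := Finset.card_eq_two.1 h
      exact ⟨i, j, rfl⟩

theorem stmt10 {m : ℕ} (hm : 3 ≤ m) (A B : Fin m → ZMod 2)
    (hBA : supp B ⊂ supp A)
    (D : Finset (Fin m → ZMod 2)) (hD : D = delta A \ delta B) :
    codeC D ≤ dualCode (codeC D) ↔ ((wt B = 0 ∧ 3 ≤ wt A) ∨ 3 ≤ wt B) := by
  have hsub : delta B ⊆ delta A := fun v hv =>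
    mem_delta.2 ((mem_delta.1 hv).trans hBA.subset)
  have hsum (i j : Fin m) :
      ∑ g ∈ D, g i * g j = 0 ↔ supp A ≠ {i, j} ∧ supp B ≠ {i, j} := by
    rw [hD, Finset.sum_sdiff_eq_sub hsub, sum_delta_mul, sum_delta_mul]
    by_cases hA : supp A = {i, j} <;> by_cases hB : supp B = {i, j}
    · exact absurd (hB.trans hA.symm) hBA.ne
    all_goals simp [hA, hB]
  have hA := (supp A).exists_eq_pair_iff.not
  have hB := (supp B).exists_eq_pair_iff.not
  push Not at hA hB
  rw [codeC_le_dualCode_iff]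
  simp only [hsum, forall_and]
  rw [hA, hB]
  have hcard := Finset.card_lt_card hBA
  unfold wt
  omega
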